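/- Let n ≥ 2 be an integer and ξ a transcendental real number. Assume there are infinitely many integers k ≥ 3 such that both k−1 and k are good for (n, ξ). Then ŵ_n(ξ) ≤ γ_n, where γ_n is the unique root in the open interval (2n−2, 2n−1) of the cubic polynomial R_n(T) = T³ − (4n−4)T² + (5n²−11n+6)T + (−2n³+8n²−10n+3). -/

import Mathlib

open Polynomial Filter

noncomputable section

/-- Height of an integer polynomial: maximum absolute value of its coefficients. -/
def polyHeight (P : Polynomial ℤ) : ℕ :=
  P.support.sup fun i => (P.coeff i).natAbs

/-- The set of exponents `w` admissible for the uniform exponent `ŵ_n(ξ)`. -/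
def uniformExpSet (n : ℕ) (ξ : ℝ) : Set ℝ :=
  {w | ∀ᶠ X : ℝ in atTop, ∃ P : Polynomial ℤ, P.natDegree ≤ n ∧
    (polyHeight P : ℝ) ≤ X ∧ 0 < |Polynomial.aeval ξ P| ∧
    |Polynomial.aeval ξ P| < X ^ (-w)}

/-- The uniform exponent `ŵ_n(ξ)`, as an extended real. -/
def wHat (n : ℕ) (ξ : ℝ) : EReal :=
  sSup ((fun w : ℝ => (w : EReal)) '' uniformExpSet n ξ)

/-- The set of exponents `w` admissible for the ordinary exponent `w_n(ξ)`. -/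
def ordExpSet (n : ℕ) (ξ : ℝ) : Set ℝ :=
  {w | {P : Polynomial ℤ | P.natDegree ≤ n ∧ 0 < |Polynomial.aeval ξ P| ∧
      |Polynomial.aeval ξ P| < (polyHeight P : ℝ) ^ (-w)}.Infinite}

/-- The ordinary exponent `w_n(ξ)`, as an extended real. -/
def wOrd (n : ℕ) (ξ : ℝ) : EReal :=
  sSup ((fun w : ℝ => (w : EReal)) '' ordExpSet n ξ)

/-- `P` (1-indexed: the relevant values are `P 1, P 2, …`) is the sequence of best
approximation polynomials associated to `(n, ξ)`. -/
structure IsBestApproxSeq (n : ℕ) (ξ : ℝ) (P : ℕ → Polynomial ℤ) : Prop where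
  ne_zero : ∀ k, 1 ≤ k → P k ≠ 0
  deg_le : ∀ k, 1 ≤ k → (P k).natDegree ≤ n
  height_lt : ∀ k, 1 ≤ k → polyHeight (P k) < polyHeight (P (k+1))
  eval_lt : ∀ k, 1 ≤ k → |Polynomial.aeval ξ (P (k+1))| < |Polynomial.aeval ξ (P k)|
  isMin : ∀ k, 1 ≤ k → ∀ Q : Polynomial ℤ, Q ≠ 0 → Q.natDegree ≤ n →
    polyHeight Q ≤ polyHeight (P k) →
    |Polynomial.aeval ξ (P k)| ≤ |Polynomial.aeval ξ Q|
  complete : ∀ Q : Polynomial ℤ, Q ≠ 0 → Q.natDegree ≤ n →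
    (∀ R : Polynomial ℤ, R ≠ 0 → R.natDegree ≤ n → polyHeight R ≤ polyHeight Q →
      |Polynomial.aeval ξ Q| ≤ |Polynomial.aeval ξ R|) →
    ∃ k, 1 ≤ k ∧ (Q = P k ∨ Q = -P k)

/-- The image of an integer polynomial in `ℚ[X]`. -/
def ratPoly (P : Polynomial ℤ) : Polynomial ℚ := P.map (Int.castRingHom ℚ)

/-- `k` is good for the sequence `P`: `P_{k-1}, P_k, P_{k+1}` are `ℚ`-linearly independent. -/
def Good (P : ℕ → Polynomial ℤ) (k : ℕ) : Prop :=
  LinearIndependent ℚ ![ratPoly (P (k-1)), ratPoly (P k), ratPoly (P (k+1))]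

/-- `τ_k = log H_k / log H_{k-1}`. -/
def tauk (P : ℕ → Polynomial ℤ) (k : ℕ) : ℝ :=
  Real.log (polyHeight (P k)) / Real.log (polyHeight (P (k-1)))

/-- `μ_k = -log |P_{k-1}(ξ)| / log H_k`. -/
def muk (ξ : ℝ) (P : ℕ → Polynomial ℤ) (k : ℕ) : ℝ :=
  - Real.log |Polynomial.aeval ξ (P (k-1))| / Real.log (polyHeight (P k))

/-- `v_k = -log |P_k(ξ)| / log H_k`. -/
def vk (ξ : ℝ) (P : ℕ → Polynomial ℤ) (k : ℕ) : ℝ :=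
  - Real.log |Polynomial.aeval ξ (P k)| / Real.log (polyHeight (P k))

/-- The set of integers `m ≥ k+1` such that `P_{k-1}, …, P_{m-1}` all lie in the
two-dimensional space spanned by `P_{k-1}` and `P_k`; its greatest element is `ℓ(k)`. -/
def ellSet (P : ℕ → Polynomial ℤ) (k : ℕ) : Set ℕ :=
  {m | k + 1 ≤ m ∧ ∀ j, k - 1 ≤ j → j ≤ m - 1 →
    ratPoly (P j) ∈ Submodule.span ℚ {ratPoly (P (k-1)), ratPoly (P k)}}

/-- The set `V_k = {P, T·P, …, T^{n-2}·P}` (as rational polynomials). -/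
def Vset (n : ℕ) (A : Polynomial ℤ) : Set (Polynomial ℚ) :=
  {q | ∃ i ≤ n - 2, q = Polynomial.X ^ i * ratPoly A}

/-- The trajectory `L_P(q) = max(log H(P) - q/(2n-2), log |P(ξ)| + q)`. -/
def LPtraj (n : ℕ) (ξ : ℝ) (Q : Polynomial ℤ) (q : ℝ) : ℝ :=
  max (Real.log (polyHeight Q) - q / (2*(n:ℝ)-2)) (Real.log |Polynomial.aeval ξ Q| + q)

/-- The `j`-th successive minimum function `L_j(q)`: the infimum over sets of `j`
linearly independent integer polynomials of degree at most `2n-2` of the maximum of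
`L_P(q)` over the set. -/
def Lj (n : ℕ) (ξ : ℝ) (j : ℕ) (q : ℝ) : ℝ :=
  sInf {y : ℝ | ∃ S : Finset (Polynomial ℤ), S.card = j ∧
    (∀ Q ∈ S, Q.natDegree ≤ 2*n-2) ∧
    LinearIndependent ℚ (fun Q : {x // x ∈ S} => ratPoly (Q : Polynomial ℤ)) ∧
    y = sSup ((fun Q => LPtraj n ξ Q q) '' (S : Set (Polynomial ℤ)))}

theorem natAbs_coeff_le_polyHeight (A : ℤ[X]) (i : ℕ) : (A.coeff i).natAbs ≤ polyHeight A := by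
  by_cases hi : i ∈ A.support
  · exact Finset.le_sup (f := fun i => (A.coeff i).natAbs) hi
  · simp [notMem_support_iff.mp hi]

theorem abs_coeff_le_polyHeight (A : ℤ[X]) (i : ℕ) :
    |(A.coeff i : ℝ)| ≤ polyHeight A := by
  have h := natAbs_coeff_le_polyHeight A i
  have h' : ((A.coeff i).natAbs : ℝ) ≤ polyHeight A := by exact_mod_cast h
  rwa [Nat.cast_natAbs, Int.cast_abs] at h'

theorem polyHeight_le_iff (A : ℤ[X]) (h : ℕ) :
    polyHeight A ≤ h ↔ ∀ i, (A.coeff i).natAbs ≤ h :=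
  ⟨fun hA i => (natAbs_coeff_le_polyHeight A i).trans hA, fun hA => Finset.sup_le fun i _ => hA i⟩

theorem one_le_polyHeight {A : ℤ[X]} (hA : A ≠ 0) : 1 ≤ polyHeight A := by
  refine le_trans ?_ (natAbs_coeff_le_polyHeight A A.natDegree)
  have : A.coeff A.natDegree ≠ 0 := by simpa using hA
  omega

theorem polyHeight_X_pow_mul (i : ℕ) (A : ℤ[X]) : polyHeight (X ^ i * A) = polyHeight A := by
  apply le_antisymm
  · rw [polyHeight_le_iff]
    intro j
    rw [coeff_X_pow_mul']
    split_ifs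
    · exact natAbs_coeff_le_polyHeight _ _
    · simp
  · rw [polyHeight_le_iff]
    intro j
    have := natAbs_coeff_le_polyHeight (X ^ i * A) (j + i)
    rwa [coeff_X_pow_mul] at this

/-- Determinant estimate: linearly independent integer polynomials of small degree cannot all be
small at `ξ` relative to their heights. -/
theorem one_le_factorial_mul_prod_polyHeight {ι : Type*} [Fintype ι] [DecidableEq ι] [Nonempty ι]
    (F : ι → ℤ[X]) (hdeg : ∀ i, (F i).natDegree < Fintype.card ι)
    (hind : LinearIndependent ℤ F) (ξ δ : ℝ)
    (hδ : ∀ i, |aeval ξ (F i)| ≤ δ * polyHeight (F i)) :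
    1 ≤ ((Fintype.card ι).factorial : ℝ) * (δ * ∏ i, (polyHeight (F i) : ℝ)) := by
  classical
  let e : ι ≃ Fin (Fintype.card ι) := Fintype.equivFin ι
  let M : Matrix ι ι ℤ := fun i j => (F i).coeff (e j)
  have hM : M.det ≠ 0 := by
    rw [Ne, ← Matrix.exists_vecMul_eq_zero_iff]
    rintro ⟨v, hv, hvM⟩
    apply hv
    funext i
    refine Fintype.linearIndependent_iff.mp hind v ?_ i
    ext j
    by_cases hj : j < Fintype.card ι
    · have := congrFun hvM (e.symm ⟨j, hj⟩)
      simpa [Matrix.vecMul, dotProduct, M, finsetSum_coeff] using this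
    · rw [finsetSum_coeff]
      simp only [coeff_smul, coeff_zero]
      refine Finset.sum_eq_zero fun i _ => ?_
      rw [coeff_eq_zero_of_natDegree_lt (by have := hdeg i; omega), smul_zero]
  have hpos : 0 < Fintype.card ι := Fintype.card_pos
  let z : ι := e.symm ⟨0, hpos⟩
  let N : Matrix ι ι ℝ := M.map (Int.cast)
  let N' : Matrix ι ι ℝ := N.updateCol z (fun k => ∑ i, ξ ^ (e i : ℕ) • N k i)
  have hN' : N'.det = M.det := by
    have := Matrix.det_updateCol_sum N z (fun i => ξ ^ (e i : ℕ))
    rw [show N'.det = _ from this]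
    have h2 : N.det = (M.det : ℝ) := (Int.cast_det M).symm
    simp [z, h2]
  have hcol : ∀ k, N' k z = aeval ξ (F k) := by
    intro k
    simp only [N', Matrix.updateCol_self]
    rw [aeval_eq_sum_range' (hdeg k), ← Fin.sum_univ_eq_sum_range
      (fun i => (F k).coeff i • ξ ^ i)]
    rw [← Equiv.sum_comp e]
    refine Finset.sum_congr rfl fun i _ => ?_
    rw [show N k i = ((F k).coeff (e i) : ℝ) from rfl, smul_eq_mul, zsmul_eq_mul, mul_comm]
  have hone : (1 : ℝ) ≤ |N'.det| := by
    rw [hN', ← Int.cast_abs]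
    exact_mod_cast Int.one_le_abs hM
  refine hone.trans ?_
  rw [Matrix.det_apply]
  refine (Finset.abs_sum_le_sum_abs _ _).trans ?_
  have hterm : ∀ σ : Equiv.Perm ι,
      |Equiv.Perm.sign σ • ∏ i, N' (σ i) i| ≤ δ * ∏ i, (polyHeight (F i) : ℝ) := by
    intro σ
    have h1 : |Equiv.Perm.sign σ • ∏ i, N' (σ i) i| = ∏ i, |N' (σ i) i| := by
      rw [← Finset.abs_prod]
      rcases Int.units_eq_one_or (Equiv.Perm.sign σ) with h | h <;> simp [h]
    rw [h1]
    have h2 : δ * ∏ i, (polyHeight (F i) : ℝ) =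
        ∏ i, ((if i = z then δ else 1) * (polyHeight (F (σ i)) : ℝ)) := by
      rw [Finset.prod_mul_distrib, Finset.prod_ite_eq' Finset.univ z,
        Equiv.prod_comp σ (fun i => (polyHeight (F i) : ℝ))]
      simp
    rw [h2]
    refine Finset.prod_le_prod (fun _ _ => abs_nonneg _) fun i _ => ?_
    by_cases hi : i = z
    · subst hi
      rw [hcol, if_pos rfl]
      exact hδ _
    · rw [if_neg hi, one_mul]
      simp only [N', Matrix.updateCol_ne hi]
      exact abs_coeff_le_polyHeight _ _
  refine (Finset.sum_le_sum fun σ _ => hterm σ).trans ?_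
  simp [Fintype.card_perm]

theorem eq_zero_of_mul_add_mul_eq_zero {Q P A B : ℤ[X]} (hQ : Prime Q) (hQP : ¬ Q ∣ P)
    (hB : B.degree < Q.degree) (h : A * Q + B * P = 0) : A = 0 ∧ B = 0 := by
  have h1 : Q ∣ B * P := ⟨-A, by linear_combination h⟩
  have h2 : B = 0 := by
    rcases hQ.dvd_or_dvd h1 with h2 | h2
    · exact eq_zero_of_dvd_of_degree_lt h2 hB
    · exact absurd h2 hQP
  refine ⟨?_, h2⟩
  rw [h2, zero_mul, add_zero] at h
  exact (mul_eq_zero.mp h).resolve_right hQ.ne_zero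

theorem ofFn_eq_zero {m : ℕ} {c : Fin m → ℤ} (h : ofFn m c = 0) (i : Fin m) : c i = 0 := by
  have := ofFn_coeff_eq_val_of_lt c i.2
  rw [h] at this
  simpa using this.symm

theorem sum_smul_X_pow_mul {m : ℕ} (c : Fin m → ℤ) (A : ℤ[X]) :
    ∑ i, c i • (X ^ (i : ℕ) * A) = ofFn m c * A := by
  rw [ofFn_eq_sum_monomial, Finset.sum_mul]
  refine Finset.sum_congr rfl fun i _ => ?_
  rw [← C_mul_X_pow_eq_monomial, zsmul_eq_mul]
  simp [mul_assoc]

theorem linearIndependent_shifts {Q P : ℤ[X]} (hQ : Prime Q) (hQP : ¬ Q ∣ P) (r m : ℕ)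
    (hm : m ≤ Q.natDegree) :
    LinearIndependent ℤ (Sum.elim (fun i : Fin r => X ^ (i : ℕ) * Q)
      (fun j : Fin m => X ^ (j : ℕ) * P)) := by
  rw [Fintype.linearIndependent_iff]
  intro c hc
  rw [Fintype.sum_sum_type] at hc
  simp only [Sum.elim_inl, Sum.elim_inr] at hc
  rw [sum_smul_X_pow_mul (fun i => c (Sum.inl i)), sum_smul_X_pow_mul (fun i => c (Sum.inr i))] at hc
  obtain ⟨h1, h2⟩ := eq_zero_of_mul_add_mul_eq_zero hQ hQP
    ((ofFn_degree_lt _).trans_le (by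
      rw [degree_eq_natDegree hQ.ne_zero]; exact_mod_cast hm)) hc
  rintro (i | i)
  · exact ofFn_eq_zero h1 i
  · exact ofFn_eq_zero h2 i

theorem exists_shift_linearIndependent {n : ℕ} (hn : 2 ≤ n) {Q P R : ℤ[X]} (hQ : Prime Q)
    (hQP : ¬ Q ∣ P) (hQn : Q.natDegree = n)
    (hR : ∀ a b c : ℤ, C c * R = C a * Q + C b * P → c = 0) :
    ∃ j ≤ n - 2, LinearIndependent ℤ (Sum.elim
      (Sum.elim (fun i : Fin (n - 1) => X ^ (i : ℕ) * Q) (fun i : Fin (n - 1) => X ^ (i : ℕ) * P))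
      (fun _ : Unit => X ^ j * R)) := by
  by_contra! hcon
  have hQd : Q.degree = n := by rw [degree_eq_natDegree hQ.ne_zero, hQn]
  have key : ∀ j ≤ n - 2, ∃ (c : ℤ) (A B : ℤ[X]), c ≠ 0 ∧ A.natDegree ≤ n - 2 ∧
      B.natDegree ≤ n - 2 ∧ C c * (X ^ j * R) = A * Q + B * P := by
    intro j hj
    obtain ⟨g, hg, hg0⟩ := Fintype.not_linearIndependent_iff.mp (hcon j hj)
    rw [Fintype.sum_sum_type, Fintype.sum_sum_type] at hg
    simp only [Sum.elim_inl, Sum.elim_inr] at hg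
    rw [sum_smul_X_pow_mul (fun i => g (Sum.inl (Sum.inl i))),
      sum_smul_X_pow_mul (fun i => g (Sum.inl (Sum.inr i)))] at hg
    simp only [Finset.univ_unique, Finset.sum_singleton, zsmul_eq_mul] at hg
    have hd : ∀ c : Fin (n - 1) → ℤ, (ofFn (n - 1) c).natDegree ≤ n - 2 := fun c => by
      have := ofFn_natDegree_lt (n := n - 1) (by omega) c
      omega
    refine ⟨- g (Sum.inr ()), ofFn (n - 1) fun i => g (Sum.inl (Sum.inl i)),
      ofFn (n - 1) fun i => g (Sum.inl (Sum.inr i)), ?_, hd _, hd _, ?_⟩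
    · intro h0
      have h0' : g (Sum.inr ()) = 0 := by simpa using h0
      obtain ⟨i, hi⟩ := hg0
      apply hi
      simp only [PUnit.default_eq_unit, h0', Int.cast_zero, zero_mul, add_zero] at hg
      obtain ⟨h1, h2⟩ := eq_zero_of_mul_add_mul_eq_zero hQ hQP
        ((ofFn_degree_lt _).trans_le (by rw [hQd]; exact_mod_cast Nat.sub_le n 1)) hg
      rcases i with (i | i) | i
      · exact ofFn_eq_zero h1 i
      · exact ofFn_eq_zero h2 i
      · exact h0'
    · rw [C_neg]
      simp only [eq_intCast, PUnit.default_eq_unit] at hg ⊢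
      linear_combination -hg
  obtain ⟨c, A, B, hc, hA, hB, h⟩ := key 0 (Nat.zero_le _)
  rw [pow_zero, one_mul] at h
  have hd0 : max A.natDegree B.natDegree ≠ 0 := by
    intro hd
    have hA0 : A.natDegree = 0 := by omega
    have hB0 : B.natDegree = 0 := by omega
    rw [eq_C_of_natDegree_eq_zero hA0, eq_C_of_natDegree_eq_zero hB0] at h
    exact hc (hR _ _ _ h)
  set d := max A.natDegree B.natDegree with hd
  obtain ⟨c', A', B', hc', hA', hB', h'⟩ := key (n - 1 - d) (by omega)
  have hz : (C c' * X ^ (n - 1 - d) * A - C c * A') * Q +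
      (C c' * X ^ (n - 1 - d) * B - C c * B') * P = 0 := by
    linear_combination C c * h' - C c' * X ^ (n - 1 - d) * h
  have hdeg : (C c' * X ^ (n - 1 - d) * B - C c * B').degree < Q.degree := by
    refine degree_lt_degree ?_
    rw [hQn]
    have h1 : (C c' * X ^ (n - 1 - d) * B).natDegree ≤ (n - 1 - d) + B.natDegree :=
      natDegree_mul_le.trans (by gcongr; exact natDegree_C_mul_X_pow_le _ _)
    have h2 : (C c * B').natDegree ≤ B'.natDegree := natDegree_C_mul_le _ _
    have h3 := natDegree_sub_le (C c' * X ^ (n - 1 - d) * B) (C c * B')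
    omega
  obtain ⟨hA2, hB2⟩ := eq_zero_of_mul_add_mul_eq_zero hQ hQP hdeg hz
  have aux : ∀ D D' : ℤ[X], D'.natDegree ≤ n - 2 → C c' * X ^ (n - 1 - d) * D - C c * D' = 0 →
      D ≠ 0 → (n - 1 - d) + D.natDegree ≤ n - 2 := by
    intro D D' hD' hDD hD
    have h1 : (C c' * X ^ (n - 1 - d) * D).natDegree = (n - 1 - d) + D.natDegree := by
      rw [natDegree_mul (by simp [hc']) hD, natDegree_C_mul_X_pow _ _ hc']
    rw [← h1, sub_eq_zero.mp hDD]
    exact (natDegree_C_mul_le _ _).trans hD'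
  have hA3 : A.natDegree ≠ d := by
    intro hAd
    have := aux A A' hA' hA2 (by rintro rfl; simp at hAd; omega)
    omega
  have hB3 : B.natDegree ≠ d := by
    intro hBd
    have := aux B B' hB' hB2 (by rintro rfl; simp at hBd; omega)
    omega
  omega

/-- Constant appearing in the resultant-type estimates in degree `n` at the point `ξ`. -/
def resultantConst (n : ℕ) (ξ : ℝ) : ℝ := (2 * n).factorial * max 1 |ξ| ^ n

theorem resultantConst_pos (n : ℕ) (ξ : ℝ) : 0 < resultantConst n ξ := by
  have : 0 < max 1 |ξ| := lt_max_of_lt_left one_pos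
  unfold resultantConst
  positivity

theorem abs_aeval_X_pow_mul_le {n i : ℕ} (hi : i ≤ n) (ξ δ : ℝ) (A : ℤ[X])
    (hA : |aeval ξ A| ≤ δ * polyHeight A) :
    |aeval ξ (X ^ i * A)| ≤ max 1 |ξ| ^ n * δ * polyHeight (X ^ i * A) := by
  rw [polyHeight_X_pow_mul, map_mul, map_pow, aeval_X, abs_mul, abs_pow, mul_assoc]
  have h1 : |ξ| ^ i ≤ max 1 |ξ| ^ n :=
    (pow_le_pow_left₀ (abs_nonneg _) (le_max_right _ _) i).trans
      (pow_le_pow_right₀ (le_max_left _ _) hi)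
  exact mul_le_mul h1 hA (abs_nonneg _) (by positivity)

theorem one_le_resultantConst_mul_of_card_le {ι : Type*} [Fintype ι] [DecidableEq ι] [Nonempty ι]
    (n : ℕ) (hcard : Fintype.card ι ≤ 2 * n) (F : ι → ℤ[X])
    (hdeg : ∀ i, (F i).natDegree < Fintype.card ι) (hind : LinearIndependent ℤ F)
    (ξ δ : ℝ) (hδ0 : 0 ≤ δ)
    (hδ : ∀ i, |aeval ξ (F i)| ≤ max 1 |ξ| ^ n * δ * polyHeight (F i)) :
    1 ≤ resultantConst n ξ * δ * ∏ i, (polyHeight (F i) : ℝ) := by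
  refine (one_le_factorial_mul_prod_polyHeight F hdeg hind ξ _ hδ).trans ?_
  have h1 : ((Fintype.card ι).factorial : ℝ) ≤ (2 * n).factorial := by
    exact_mod_cast Nat.factorial_le hcard
  have h2 : 0 ≤ max 1 |ξ| ^ n * δ * ∏ i, (polyHeight (F i) : ℝ) := by positivity
  calc _ ≤ ((2 * n).factorial : ℝ) * (max 1 |ξ| ^ n * δ * ∏ i, (polyHeight (F i) : ℝ)) :=
        mul_le_mul_of_nonneg_right h1 h2
    _ = _ := by unfold resultantConst; ring

/-- Resultant estimate for two coprime polynomials. -/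
theorem one_le_of_prime_of_not_dvd {n m : ℕ} (hm : 1 ≤ m) (hmn : m ≤ n) {Q P : ℤ[X]}
    (hQ : Prime Q) (hQm : Q.natDegree = m) (hP : P.natDegree ≤ n) (hQP : ¬ Q ∣ P)
    (ξ δ : ℝ) (hδ0 : 0 ≤ δ) (hδQ : |aeval ξ Q| ≤ δ * polyHeight Q)
    (hδP : |aeval ξ P| ≤ δ * polyHeight P) :
    1 ≤ resultantConst n ξ * δ * ((polyHeight Q : ℝ) ^ n * (polyHeight P : ℝ) ^ m) := by
  have : Nonempty (Fin n ⊕ Fin m) := ⟨Sum.inr ⟨0, hm⟩⟩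
  have key := one_le_resultantConst_mul_of_card_le n (ι := Fin n ⊕ Fin m)
    (by simp; omega) _ ?_ (linearIndependent_shifts hQ hQP n m hQm.ge) ξ δ hδ0 ?_
  · simpa [Fintype.prod_sum_type, polyHeight_X_pow_mul] using key
  · rintro (i | i)
    · have := natDegree_mul_le (p := X ^ (i : ℕ)) (q := Q)
      rw [natDegree_X_pow] at this
      simp
      omega
    · have := natDegree_mul_le (p := X ^ (i : ℕ)) (q := P)
      rw [natDegree_X_pow] at this
      simp
      omega
  · rintro (i | i)
    · exact abs_aeval_X_pow_mul_le (by omega) ξ δ Q hδQ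
    · exact abs_aeval_X_pow_mul_le (by omega) ξ δ P hδP

/-- Determinant estimate for three linearly independent polynomials, two of which are coprime. -/
theorem one_le_of_linearIndependent_three {n : ℕ} (hn : 2 ≤ n) {Q P R : ℤ[X]} (hQ : Prime Q)
    (hQP : ¬ Q ∣ P) (hQn : Q.natDegree = n) (hP : P.natDegree ≤ n) (hRn : R.natDegree ≤ n)
    (hR : ∀ a b c : ℤ, C c * R = C a * Q + C b * P → c = 0)
    (ξ δ : ℝ) (hδ0 : 0 ≤ δ) (hδQ : |aeval ξ Q| ≤ δ * polyHeight Q)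
    (hδP : |aeval ξ P| ≤ δ * polyHeight P) (hδR : |aeval ξ R| ≤ δ * polyHeight R) :
    1 ≤ resultantConst n ξ * δ * ((polyHeight Q : ℝ) ^ (n - 1) * (polyHeight P : ℝ) ^ (n - 1)
      * polyHeight R) := by
  obtain ⟨j, hj, hind⟩ := exists_shift_linearIndependent hn hQ hQP hQn hR
  have key := one_le_resultantConst_mul_of_card_le n (by simp; omega) _ ?_ hind ξ δ hδ0 ?_
  · simpa [Fintype.prod_sum_type, polyHeight_X_pow_mul] using key
  · rintro ((i | i) | i)
    · have := natDegree_mul_le (p := X ^ (i : ℕ)) (q := Q)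
      rw [natDegree_X_pow] at this
      simp
      omega
    · have := natDegree_mul_le (p := X ^ (i : ℕ)) (q := P)
      rw [natDegree_X_pow] at this
      simp
      omega
    · have := natDegree_mul_le (p := X ^ j) (q := R)
      rw [natDegree_X_pow] at this
      simp
      omega
  · rintro ((i | i) | i)
    · exact abs_aeval_X_pow_mul_le (by omega) ξ δ Q hδQ
    · exact abs_aeval_X_pow_mul_le (by omega) ξ δ P hδP
    · exact abs_aeval_X_pow_mul_le (by omega) ξ δ R hδR

/-- Mahler measure of an integer polynomial. -/
def intMahler (A : ℤ[X]) : ℝ := (A.map (Int.castRingHom ℂ)).mahlerMeasure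

theorem intMahler_mul (A B : ℤ[X]) : intMahler (A * B) = intMahler A * intMahler B := by
  simp [intMahler, Polynomial.map_mul, mahlerMeasure_mul]

theorem one_le_intMahler {A : ℤ[X]} (hA : A ≠ 0) : 1 ≤ intMahler A :=
  one_le_mahlerMeasure_of_ne_zero hA

theorem intMahler_le {n : ℕ} {A : ℤ[X]} (hA : A.natDegree ≤ n) :
    intMahler A ≤ (n + 1) * polyHeight A := by
  refine (mahlerMeasure_le_sum_norm_coeff _).trans ?_
  have h1 : (A.map (Int.castRingHom ℂ)).natDegree < n + 1 :=
    Nat.lt_succ_of_le (natDegree_map_le.trans hA)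
  rw [sum_over_range' _ (by simp) (n + 1) h1]
  refine (Finset.sum_le_card_nsmul _ _ (polyHeight A : ℝ) fun i _ => ?_).trans (by simp)
  simpa using abs_coeff_le_polyHeight A i

theorem polyHeight_le_intMahler {n : ℕ} {A : ℤ[X]} (hA : A.natDegree ≤ n) :
    (polyHeight A : ℝ) ≤ 2 ^ n * intMahler A := by
  have h : ∀ i, ((A.coeff i).natAbs : ℝ) ≤ 2 ^ n * intMahler A := by
    intro i
    have h1 := norm_coeff_le_choose_mul_mahlerMeasure i (A.map (Int.castRingHom ℂ))
    have h2 : ((A.coeff i).natAbs : ℝ) = ‖(A.map (Int.castRingHom ℂ)).coeff i‖ := by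
      simp [Nat.cast_natAbs]
    rw [h2]
    refine h1.trans ?_
    refine mul_le_mul_of_nonneg_right ?_ (mahlerMeasure_nonneg _)
    exact_mod_cast (Nat.choose_le_two_pow _ _).trans
      (Nat.pow_le_pow_right two_pos (natDegree_map_le.trans hA))
  by_cases hA0 : A.support.Nonempty
  · obtain ⟨i, -, hi⟩ := Finset.exists_mem_eq_sup A.support hA0 fun i => (A.coeff i).natAbs
    rw [polyHeight, hi]
    exact h i
  · have h1 := h 0
    rw [Finset.not_nonempty_iff_eq_empty] at hA0
    rw [polyHeight, hA0]
    exact le_trans (by simp) h1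

theorem polyHeight_le_of_dvd {n : ℕ} {Q P : ℤ[X]} (hP : P.natDegree ≤ n) (hP0 : P ≠ 0)
    (h : Q ∣ P) : (polyHeight Q : ℝ) ≤ 2 ^ n * (n + 1) * polyHeight P := by
  have hQ := polyHeight_le_intMahler ((natDegree_le_of_dvd h hP0).trans hP)
  obtain ⟨B, rfl⟩ := h
  have hB : B ≠ 0 := right_ne_zero_of_mul hP0
  have hQ0 : Q ≠ 0 := left_ne_zero_of_mul hP0
  have h1 := intMahler_le hP
  rw [intMahler_mul] at h1
  have h2 := one_le_intMahler hB
  have h3 := one_le_intMahler hQ0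
  calc (polyHeight Q : ℝ) ≤ 2 ^ n * intMahler Q := hQ
    _ ≤ 2 ^ n * ((n + 1) * polyHeight (Q * B)) := by
        gcongr
        nlinarith
    _ = _ := by ring

theorem finite_polyHeight_le (n : ℕ) (h : ℝ) :
    {A : ℤ[X] | A.natDegree ≤ n ∧ (polyHeight A : ℝ) ≤ h}.Finite := by
  refine (finite_mahlerMeasure_le n (Real.toNNReal ((n + 1) * h))).subset ?_
  rintro A ⟨hA, hh⟩
  refine ⟨hA, (intMahler_le hA).trans ?_⟩
  refine le_trans ?_ (Real.le_coe_toNNReal _)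
  gcongr

theorem aeval_int_ne_zero {ξ : ℝ} (hξ : Transcendental ℚ ξ) {A : ℤ[X]} (hA : A ≠ 0) :
    aeval ξ A ≠ 0 := by
  intro h
  refine hξ ⟨A.map (algebraMap ℤ ℚ), ?_, ?_⟩
  · rwa [Ne, Polynomial.map_eq_zero_iff (algebraMap ℤ ℚ).injective_int]
  · rwa [aeval_map_algebraMap]

theorem abs_aeval_int_pos {ξ : ℝ} (hξ : Transcendental ℚ ξ) {A : ℤ[X]} (hA : A ≠ 0) :
    0 < |aeval ξ A| := abs_pos.mpr (aeval_int_ne_zero hξ hA)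

theorem exists_pos_le_of_polyHeight_le {ξ : ℝ} (hξ : Transcendental ℚ ξ) (n : ℕ) (h : ℝ) :
    ∃ c > 0, ∀ A : ℤ[X], A ≠ 0 → A.natDegree ≤ n → (polyHeight A : ℝ) ≤ h → c ≤ |aeval ξ A| := by
  have hfin : {A : ℤ[X] | A ≠ 0 ∧ A.natDegree ≤ n ∧ (polyHeight A : ℝ) ≤ h}.Finite :=
    (finite_polyHeight_le n h).subset fun A hA => hA.2
  rcases Set.eq_empty_or_nonempty {A : ℤ[X] | A ≠ 0 ∧ A.natDegree ≤ n ∧ (polyHeight A : ℝ) ≤ h}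
    with he | hne
  · refine ⟨1, one_pos, fun A h1 h2 h3 => ?_⟩
    have : A ∈ {A : ℤ[X] | A ≠ 0 ∧ A.natDegree ≤ n ∧ (polyHeight A : ℝ) ≤ h} := ⟨h1, h2, h3⟩
    simp [he] at this
  · obtain ⟨B, hB, hmin⟩ := Set.exists_min_image _ (fun A => |aeval ξ A|) hfin hne
    exact ⟨_, abs_aeval_int_pos hξ hB.1, fun A h1 h2 h3 => hmin A ⟨h1, h2, h3⟩⟩

theorem exists_lower_bound_of_prime_of_large {n : ℕ} (hn : 2 ≤ n) {ξ w : ℝ}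
    (hw : w ∈ uniformExpSet n ξ) (hwn : 2 * (n : ℝ) - 2 < w) :
    ∃ c > 0, ∃ h : ℝ, ∀ Q : ℤ[X], Prime Q → 1 ≤ Q.natDegree → Q.natDegree ≤ n - 1 →
      h ≤ polyHeight Q → c ≤ |aeval ξ Q| * (polyHeight Q : ℝ) ^ (2 * n - 2) := by
  set K := resultantConst n ξ with hK
  have hKpos : 0 < K := resultantConst_pos n ξ
  set L : ℝ := 2 * (2 ^ n * (n + 1)) with hL
  have hL0 : 1 ≤ L := by
    have : (1 : ℝ) ≤ 2 ^ n := one_le_pow₀ (by norm_num)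
    have h2 : (0 : ℝ) ≤ n := Nat.cast_nonneg n
    nlinarith
  have hLpos : 0 < L := by linarith
  have htend : Tendsto (fun x : ℝ => K * L ^ w * x ^ (-(w - (2 * (n : ℝ) - 2)))) atTop
      (nhds (K * L ^ w * 0)) :=
    (tendsto_rpow_neg_atTop (by linarith)).const_mul _
  rw [mul_zero] at htend
  have hev := htend.eventually (gt_mem_nhds (show (0 : ℝ) < 1 / 2 by norm_num))
  have hdiv : Tendsto (fun x : ℝ => x / L) atTop atTop := tendsto_id.atTop_div_const hLpos
  obtain ⟨h, hh⟩ := eventually_atTop.mp (hev.and (hdiv.eventually hw))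
  refine ⟨1 / (2 * K), by positivity, h, fun Q hQ hQ1 hQn hhQ => ?_⟩
  obtain ⟨hsmall, P, hPn, hPX, hPpos, hPlt⟩ := hh _ hhQ
  have hH1 : (1 : ℝ) ≤ polyHeight Q := by exact_mod_cast one_le_polyHeight hQ.ne_zero
  set H : ℝ := (polyHeight Q : ℝ) with hH
  have hP0 : P ≠ 0 := by
    rintro rfl
    simp at hPpos
  have hp1 : (1 : ℝ) ≤ polyHeight P := by exact_mod_cast one_le_polyHeight hP0
  have hndvd : ¬ Q ∣ P := by
    intro hdvd
    have h1 := polyHeight_le_of_dvd hPn hP0 hdvd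
    have h2 : L * polyHeight P ≤ H := by
      rw [le_div_iff₀ hLpos] at hPX
      linarith
    have h3 : L * (polyHeight P : ℝ) = 2 * (2 ^ n * (n + 1) * polyHeight P) := by rw [hL]; ring
    linarith
  have hpH : (polyHeight P : ℝ) ≤ H := hPX.trans (div_le_self (by linarith) hL0)
  set p : ℝ := (polyHeight P : ℝ) with hp
  have hppos : 0 < p := by linarith
  have hHpos : 0 < H := by linarith
  obtain ⟨m, hm⟩ : ∃ m, Q.natDegree = m + 1 := ⟨Q.natDegree - 1, by omega⟩
  obtain ⟨r, hr⟩ : ∃ r, n = r + 1 := ⟨n - 1, by omega⟩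
  have hres := one_le_of_prime_of_not_dvd (n := n) hQ1 (by omega) hQ rfl hPn hndvd ξ
    (|aeval ξ P| / p + |aeval ξ Q| / H) (by positivity)
    (by
      rw [add_mul, div_mul_cancel₀ _ hHpos.ne']
      exact le_add_of_nonneg_left (by positivity))
    (by
      rw [add_mul, div_mul_cancel₀ _ hppos.ne']
      exact le_add_of_nonneg_right (by positivity))
  rw [← hK, ← hH, ← hp, hm] at hres
  have hexp : 2 * n - 2 = r + r := by omega
  have hmr : m + 1 ≤ r := by omega
  have e1 : K * (|aeval ξ P| / p + |aeval ξ Q| / H) * (H ^ n * p ^ (m + 1)) =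
      K * (|aeval ξ P| * (H ^ n * p ^ m) + |aeval ξ Q| * (H ^ r * p ^ (m + 1))) := by
    rw [hr]
    field_simp
    ring
  rw [e1] at hres
  have hpm : H ^ n * p ^ m ≤ H ^ (2 * n - 2) := by
    calc H ^ n * p ^ m ≤ H ^ n * H ^ m := by gcongr
      _ = H ^ (n + m) := by rw [pow_add]
      _ ≤ H ^ (2 * n - 2) := pow_le_pow_right₀ hH1 (by omega)
  have hpm' : H ^ r * p ^ (m + 1) ≤ H ^ (2 * n - 2) := by
    calc H ^ r * p ^ (m + 1) ≤ H ^ r * H ^ (m + 1) := by gcongr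
      _ = H ^ (r + (m + 1)) := by rw [pow_add _ r]
      _ ≤ H ^ (2 * n - 2) := pow_le_pow_right₀ hH1 (by omega)
  have hPsmall : K * (|aeval ξ P| * H ^ (2 * n - 2)) ≤ 1 / 2 := by
    refine le_trans ?_ hsmall.le
    have e2 : (H / L) ^ (-w) = L ^ w * H ^ (-w) := by
      rw [Real.div_rpow hHpos.le hLpos.le, Real.rpow_neg hLpos.le, div_inv_eq_mul, mul_comm]
    have e3 : H ^ (-(w - (2 * (n : ℝ) - 2))) = H ^ (-w) * H ^ (2 * n - 2) := by
      rw [← Real.rpow_natCast, ← Real.rpow_add hHpos]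
      congr 1
      rw [Nat.cast_sub (by omega)]
      push_cast
      ring
    rw [e3]
    calc K * (|aeval ξ P| * H ^ (2 * n - 2)) ≤ K * ((H / L) ^ (-w) * H ^ (2 * n - 2)) := by
          gcongr
      _ = _ := by rw [e2]; ring
  have hfin : 1 ≤ 1 / 2 + K * (|aeval ξ Q| * H ^ (2 * n - 2)) := by
    refine hres.trans ?_
    rw [mul_add]
    refine add_le_add (le_trans ?_ hPsmall) ?_
    · gcongr
    · gcongr
  rw [div_le_iff₀ (by positivity)]
  linarith

theorem exists_lower_bound_of_prime {n : ℕ} (hn : 2 ≤ n) {ξ w : ℝ} (hξ : Transcendental ℚ ξ)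
    (hw : w ∈ uniformExpSet n ξ) (hwn : 2 * (n : ℝ) - 2 < w) :
    ∃ c : ℝ, 0 < c ∧ c ≤ 1 ∧ ∀ Q : ℤ[X], Prime Q → 1 ≤ Q.natDegree → Q.natDegree ≤ n - 1 →
      c ≤ |aeval ξ Q| * intMahler Q ^ (2 * n - 2) := by
  obtain ⟨c₁, hc₁, h, hlarge⟩ := exists_lower_bound_of_prime_of_large hn hw hwn
  obtain ⟨c₂, hc₂, hsmall⟩ := exists_pos_le_of_polyHeight_le hξ n h
  refine ⟨min 1 (min c₂ (c₁ / (2 ^ n) ^ (2 * n - 2))), by positivity, min_le_left _ _,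
    fun Q hQ hQ1 hQn => ?_⟩
  have hM := one_le_intMahler hQ.ne_zero
  rcases le_total h (polyHeight Q) with hle | hle
  · refine (min_le_right _ _).trans ((min_le_right _ _).trans ?_)
    rw [div_le_iff₀ (by positivity)]
    refine (hlarge Q hQ hQ1 hQn hle).trans ?_
    have := polyHeight_le_intMahler (n := n) (A := Q) (by omega)
    calc |aeval ξ Q| * (polyHeight Q : ℝ) ^ (2 * n - 2)
        ≤ |aeval ξ Q| * (2 ^ n * intMahler Q) ^ (2 * n - 2) := by gcongr
      _ = _ := by rw [mul_pow]; ring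
  · refine (min_le_right _ _).trans ((min_le_left _ _).trans ?_)
    refine (hsmall Q hQ.ne_zero (by omega) hle).trans ?_
    exact le_mul_of_one_le_right (abs_nonneg _) (one_le_pow₀ hM)

theorem one_le_abs_aeval_of_natDegree_eq_zero {A : ℤ[X]} (hA : A ≠ 0) (hd : A.natDegree = 0)
    (ξ : ℝ) : 1 ≤ |aeval ξ A| := by
  rw [eq_C_of_natDegree_eq_zero hd] at hA ⊢
  have h0 : A.coeff 0 ≠ 0 := fun h => hA (by rw [h, C_0])
  rw [aeval_C, algebraMap_int_eq, eq_intCast, ← Int.cast_abs]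
  exact_mod_cast Int.one_le_abs h0

theorem exists_lower_bound_of_natDegree_le {n : ℕ} (hn : 2 ≤ n) {ξ w : ℝ}
    (hξ : Transcendental ℚ ξ) (hw : w ∈ uniformExpSet n ξ) (hwn : 2 * (n : ℝ) - 2 < w) :
    ∃ c > 0, ∀ A : ℤ[X], A ≠ 0 → A.natDegree ≤ n - 1 →
      c ≤ |aeval ξ A| * intMahler A ^ (2 * n - 2) := by
  obtain ⟨c, hc, hc1, hprime⟩ := exists_lower_bound_of_prime hn hξ hw hwn
  refine ⟨c ^ n, by positivity, fun A hA hAn => ?_⟩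
  suffices h : ∀ A : ℤ[X], A ≠ 0 → A.natDegree ≤ n - 1 →
      c ^ A.natDegree ≤ |aeval ξ A| * intMahler A ^ (2 * n - 2) from
    (pow_le_pow_of_le_one hc.le hc1 (by omega)).trans (h A hA hAn)
  intro A
  refine UniqueFactorizationMonoid.induction_on_prime A (fun h => absurd rfl h) ?_ ?_
  · intro u hu hu0 _
    rw [natDegree_eq_zero_of_isUnit hu, pow_zero]
    exact one_le_mul_of_one_le_of_one_le
      (one_le_abs_aeval_of_natDegree_eq_zero hu0 (natDegree_eq_zero_of_isUnit hu) ξ)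
      (one_le_pow₀ (one_le_intMahler hu0))
  · intro B Q hB hQ ih _ hdeg
    rw [natDegree_mul hQ.ne_zero hB] at hdeg ⊢
    have hB' := ih hB (by omega)
    have hQ' : c ^ Q.natDegree ≤ |aeval ξ Q| * intMahler Q ^ (2 * n - 2) := by
      rcases Nat.eq_zero_or_pos Q.natDegree with h0 | h1
      · rw [h0, pow_zero]
        exact one_le_mul_of_one_le_of_one_le
          (one_le_abs_aeval_of_natDegree_eq_zero hQ.ne_zero h0 ξ)
          (one_le_pow₀ (one_le_intMahler hQ.ne_zero))
      · exact (pow_le_of_le_one hc.le hc1 h1.ne').trans (hprime Q hQ h1 (by omega))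
    rw [pow_add, map_mul, abs_mul, intMahler_mul, mul_pow]
    calc c ^ Q.natDegree * c ^ B.natDegree ≤ (|aeval ξ Q| * intMahler Q ^ (2 * n - 2)) *
          (|aeval ξ B| * intMahler B ^ (2 * n - 2)) :=
          mul_le_mul hQ' hB' (by positivity) ((pow_pos hc _).le.trans hQ')
      _ = _ := by ring

namespace IsBestApproxSeq

variable {n : ℕ} {ξ : ℝ} {P : ℕ → ℤ[X]}

theorem polyHeight_le (hP : IsBestApproxSeq n ξ P) {i j : ℕ} (hi : 1 ≤ i) (hij : i ≤ j) :
    polyHeight (P i) ≤ polyHeight (P j) := by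
  induction j, hij using Nat.le_induction with
  | base => exact le_rfl
  | succ k hk ih => exact ih.trans (hP.height_lt k (hi.trans hk)).le

theorem le_polyHeight (hP : IsBestApproxSeq n ξ P) {k : ℕ} (hk : 1 ≤ k) :
    k ≤ polyHeight (P k) := by
  induction k, hk using Nat.le_induction with
  | base => exact one_le_polyHeight (hP.ne_zero 1 le_rfl)
  | succ k hk ih => exact ih.trans_lt (hP.height_lt k hk)

theorem abs_aeval_le (hP : IsBestApproxSeq n ξ P) {i j : ℕ} (hi : 1 ≤ i) (hij : i ≤ j) :
    |aeval ξ (P j)| ≤ |aeval ξ (P i)| := by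
  induction j, hij using Nat.le_induction with
  | base => exact le_rfl
  | succ k hk ih => exact (hP.eval_lt k (hi.trans hk)).le.trans ih

theorem abs_aeval_le_of_polyHeight_lt (hP : IsBestApproxSeq n ξ P) {k : ℕ} (hk : 1 ≤ k) {Q : ℤ[X]}
    (hQ0 : Q ≠ 0) (hQn : Q.natDegree ≤ n) (hQ : polyHeight Q < polyHeight (P (k + 1))) :
    |aeval ξ (P k)| ≤ |aeval ξ Q| := by
  have hfin : {A : ℤ[X] | A ≠ 0 ∧ A.natDegree ≤ n ∧ polyHeight A ≤ polyHeight Q}.Finite :=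
    (finite_polyHeight_le n (polyHeight Q)).subset fun A hA => ⟨hA.2.1, by exact_mod_cast hA.2.2⟩
  obtain ⟨B, ⟨hB0, hBn, hBQ⟩, hmin⟩ := Set.exists_min_image _ (fun A => |aeval ξ A|) hfin
    ⟨Q, hQ0, hQn, le_rfl⟩
  obtain ⟨j, hj, hBj⟩ := hP.complete B hB0 hBn fun R hR0 hRn hRB =>
    hmin R ⟨hR0, hRn, hRB.trans hBQ⟩
  have hev : |aeval ξ B| = |aeval ξ (P j)| := by
    rcases hBj with rfl | rfl <;> simp
  have hht : polyHeight B = polyHeight (P j) := by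
    rcases hBj with rfl | rfl <;> simp [polyHeight]
  have hjk : j ≤ k := by
    by_contra! hlt
    have := hP.polyHeight_le (i := k + 1) (by omega) hlt
    omega
  exact ((hP.abs_aeval_le hj hjk).trans hev.ge).trans (hmin Q ⟨hQ0, hQn, le_rfl⟩)

theorem tendsto_polyHeight (hP : IsBestApproxSeq n ξ P) :
    Tendsto (fun k => (polyHeight (P k) : ℝ)) atTop atTop := by
  refine tendsto_natCast_atTop_atTop.comp (tendsto_atTop_mono' atTop ?_ tendsto_id)
  filter_upwards [eventually_ge_atTop 1] with k hk using hP.le_polyHeight hk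

theorem eventually_abs_aeval_le (hP : IsBestApproxSeq n ξ P) {w : ℝ}
    (hw : w ∈ uniformExpSet n ξ) :
    ∀ᶠ k in atTop, |aeval ξ (P k)| ≤ 2 ^ w * (polyHeight (P (k + 1)) : ℝ) ^ (-w) := by
  have htend : Tendsto (fun k => (polyHeight (P (k + 1)) : ℝ) / 2) atTop atTop :=
    (hP.tendsto_polyHeight.comp (tendsto_add_atTop_nat 1)).atTop_div_const two_pos
  filter_upwards [htend.eventually hw, eventually_ge_atTop 1] with k hk hk1
  obtain ⟨Q, hQn, hQX, hQpos, hQlt⟩ := hk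
  have hQ0 : Q ≠ 0 := by
    rintro rfl
    simp at hQpos
  have hpos : (0 : ℝ) < polyHeight (P (k + 1)) := by
    exact_mod_cast one_le_polyHeight (hP.ne_zero (k + 1) (by omega))
  have hlt : polyHeight Q < polyHeight (P (k + 1)) := by
    have : (polyHeight Q : ℝ) < polyHeight (P (k + 1)) := by linarith
    exact_mod_cast this
  refine (hP.abs_aeval_le_of_polyHeight_lt hk1 hQ0 hQn hlt).trans (hQlt.le.trans_eq ?_)
  rw [Real.div_rpow hpos.le two_pos.le, Real.rpow_neg two_pos.le, div_inv_eq_mul, mul_comm]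

theorem eventually_abs_aeval_mul_intMahler_lt (hn : 2 ≤ n) (hP : IsBestApproxSeq n ξ P) {w : ℝ}
    (hw : w ∈ uniformExpSet n ξ) (hwn : 2 * (n : ℝ) - 2 < w) {ε : ℝ} (hε : 0 < ε) :
    ∀ᶠ k in atTop, |aeval ξ (P k)| * intMahler (P k) ^ (2 * n - 2) < ε := by
  have htend : Tendsto (fun x : ℝ => 2 ^ w * ((n : ℝ) + 1) ^ (2 * n - 2) *
      x ^ (-(w - (2 * (n : ℝ) - 2)))) atTop (nhds (2 ^ w * ((n : ℝ) + 1) ^ (2 * n - 2) * 0)) :=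
    (tendsto_rpow_neg_atTop (by linarith)).const_mul _
  rw [mul_zero] at htend
  filter_upwards [(htend.comp hP.tendsto_polyHeight).eventually (gt_mem_nhds hε),
    hP.eventually_abs_aeval_le hw, eventually_ge_atTop 1] with k hk hle hk1
  refine lt_of_le_of_lt ?_ hk
  have hpos : (0 : ℝ) < polyHeight (P k) := by
    exact_mod_cast one_le_polyHeight (hP.ne_zero k hk1)
  have hmono : (polyHeight (P k) : ℝ) ≤ polyHeight (P (k + 1)) := by
    exact_mod_cast (hP.height_lt k hk1).le
  have hw0 : 0 < w := by
    have : (2 : ℝ) ≤ n := by exact_mod_cast hn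
    linarith
  have h1 : (polyHeight (P (k + 1)) : ℝ) ^ (-w) ≤ (polyHeight (P k) : ℝ) ^ (-w) :=
    Real.rpow_le_rpow_of_nonpos hpos hmono (by linarith)
  have h2 := intMahler_le (hP.deg_le k hk1)
  have h3 := one_le_intMahler (hP.ne_zero k hk1)
  have e3 : (polyHeight (P k) : ℝ) ^ (-(w - (2 * (n : ℝ) - 2))) =
      (polyHeight (P k) : ℝ) ^ (-w) * (polyHeight (P k) : ℝ) ^ (2 * n - 2) := by
    rw [← Real.rpow_natCast, ← Real.rpow_add hpos]
    congr 1
    rw [Nat.cast_sub (by omega)]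
    push_cast
    ring
  simp only [Function.comp_apply]
  rw [e3]
  calc |aeval ξ (P k)| * intMahler (P k) ^ (2 * n - 2)
      ≤ (2 ^ w * (polyHeight (P k) : ℝ) ^ (-w)) * ((n + 1) * polyHeight (P k)) ^ (2 * n - 2) := by
        gcongr
        exact hle.trans (by gcongr)
    _ = _ := by rw [mul_pow]; ring

/-- For `ŵ_n(ξ) > 2n - 2`, all large best approximation polynomials are irreducible of degree
exactly `n`. -/
theorem eventually_prime (hn : 2 ≤ n) (hξ : Transcendental ℚ ξ) (hP : IsBestApproxSeq n ξ P)
    {w : ℝ} (hw : w ∈ uniformExpSet n ξ) (hwn : 2 * (n : ℝ) - 2 < w) :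
    ∀ᶠ k in atTop, Prime (P k) ∧ (P k).natDegree = n := by
  obtain ⟨c, hc, hlow⟩ := exists_lower_bound_of_natDegree_le hn hξ hw hwn
  filter_upwards [hP.eventually_abs_aeval_mul_intMahler_lt hn hw hwn hc,
    hP.eventually_abs_aeval_mul_intMahler_lt hn hw hwn (mul_pos hc hc), eventually_ge_atTop 1]
    with k hk hk2 hk1
  have hdeg : (P k).natDegree = n := by
    by_contra hne
    have := hP.deg_le k hk1
    exact absurd (hlow _ (hP.ne_zero k hk1) (by omega)) (not_le.mpr hk)
  refine ⟨?_, hdeg⟩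
  have hconst : ∀ A B : ℤ[X], P k = A * B → A.natDegree = 0 → IsUnit A := by
    intro A B hAB hA
    have hA0 : A ≠ 0 := left_ne_zero_of_mul (hAB ▸ hP.ne_zero k hk1)
    have hB0 : B ≠ 0 := right_ne_zero_of_mul (hAB ▸ hP.ne_zero k hk1)
    obtain ⟨a, rfl⟩ : ∃ a, A = C a := ⟨_, eq_C_of_natDegree_eq_zero hA⟩
    have ha0 : a ≠ 0 := by
      rintro rfl
      simp at hA0
    have hBn : B.natDegree ≤ n := by
      rw [← hdeg, hAB, natDegree_C_mul ha0]
    have hBh : polyHeight B ≤ polyHeight (P k) := by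
      rw [polyHeight_le_iff]
      intro i
      refine le_trans ?_ (natAbs_coeff_le_polyHeight (P k) i)
      rw [hAB, coeff_C_mul, Int.natAbs_mul]
      exact Nat.le_mul_of_pos_left _ (Int.natAbs_pos.mpr ha0)
    have hle := hP.isMin k hk1 B hB0 hBn hBh
    rw [hAB, map_mul, abs_mul, aeval_C, algebraMap_int_eq, eq_intCast] at hle
    have hpos := abs_aeval_int_pos hξ hB0
    have ha1 : |(a : ℝ)| ≤ 1 := le_of_mul_le_mul_right (by linarith) hpos
    rw [isUnit_C, Int.isUnit_iff_abs_eq]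
    have ha1' : |a| ≤ 1 := by exact_mod_cast ha1
    have := Int.one_le_abs ha0
    omega
  refine Irreducible.prime ⟨fun hu => ?_, fun A B hAB => ?_⟩
  · have := natDegree_eq_zero_of_isUnit hu
    omega
  · by_cases hA : A.natDegree = 0
    · exact Or.inl (hconst A B hAB hA)
    by_cases hB : B.natDegree = 0
    · exact Or.inr (hconst B A (by rw [hAB, mul_comm]) hB)
    exfalso
    have hA0 : A ≠ 0 := left_ne_zero_of_mul (hAB ▸ hP.ne_zero k hk1)
    have hB0 : B ≠ 0 := right_ne_zero_of_mul (hAB ▸ hP.ne_zero k hk1)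
    rw [hAB, natDegree_mul hA0 hB0] at hdeg
    have h1 := hlow A hA0 (by omega)
    have h2 := hlow B hB0 (by omega)
    refine absurd hk2 (not_lt.mpr ?_)
    rw [hAB, map_mul, abs_mul, intMahler_mul, mul_pow]
    calc c * c ≤ (|aeval ξ A| * intMahler A ^ (2 * n - 2)) *
          (|aeval ξ B| * intMahler B ^ (2 * n - 2)) :=
          mul_le_mul h1 h2 hc.le (hc.le.trans h1)
      _ = _ := by ring

/-- Consecutive irreducible best approximations do not divide each other. -/
theorem not_dvd_succ (hP : IsBestApproxSeq n ξ P) {k : ℕ} (hk : 1 ≤ k)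
    (hprime : Prime (P (k + 1))) (hprime' : Prime (P k)) : ¬ P (k + 1) ∣ P k := by
  intro hdvd
  obtain ⟨u, hu⟩ := (hprime.dvd_prime_iff_associated hprime').mp hdvd
  have hlt := hP.eval_lt k hk
  have hone := one_le_abs_aeval_of_natDegree_eq_zero u⁻¹.ne_zero
    (natDegree_eq_zero_of_isUnit (u⁻¹).isUnit) ξ
  have hPk : P (k + 1) = P k * ((u⁻¹ : ℤ[X]ˣ) : ℤ[X]) := by
    rw [← hu, mul_assoc, Units.mul_inv, mul_one]
  rw [hPk, map_mul, abs_mul] at hlt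
  have := abs_nonneg (aeval ξ (P k))
  nlinarith

/-- The ratios `|P_k(ξ)| / H_k` decrease. -/
theorem abs_aeval_le_div_mul (hP : IsBestApproxSeq n ξ P) {i j : ℕ} (hi : 1 ≤ i) (hij : i ≤ j) :
    |aeval ξ (P j)| ≤ |aeval ξ (P i)| / polyHeight (P i) * polyHeight (P j) := by
  have hpos : (0 : ℝ) < polyHeight (P i) := by
    exact_mod_cast one_le_polyHeight (hP.ne_zero i hi)
  have hle : (polyHeight (P i) : ℝ) ≤ polyHeight (P j) := by exact_mod_cast hP.polyHeight_le hi hij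
  rw [div_mul_eq_mul_div, le_div_iff₀ hpos]
  exact mul_le_mul (hP.abs_aeval_le hi hij) hle hpos.le (abs_nonneg _)

theorem log_abs_aeval_le (hξ : Transcendental ℚ ξ) (hP : IsBestApproxSeq n ξ P) {w : ℝ} {k : ℕ}
    (hk : 1 ≤ k) (h : |aeval ξ (P k)| ≤ 2 ^ w * (polyHeight (P (k + 1)) : ℝ) ^ (-w)) :
    Real.log |aeval ξ (P k)| ≤ w * Real.log 2 - w * Real.log (polyHeight (P (k + 1))) := by
  have hpos : (0 : ℝ) < polyHeight (P (k + 1)) := by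
    exact_mod_cast one_le_polyHeight (hP.ne_zero (k + 1) (by omega))
  have h1 := Real.log_le_log (abs_aeval_int_pos hξ (hP.ne_zero k hk)) h
  rw [Real.log_mul (by positivity) (by positivity), Real.log_rpow two_pos,
    Real.log_rpow hpos] at h1
  linarith

theorem eventually_resultant_inequality (hn : 2 ≤ n) (hξ : Transcendental ℚ ξ)
    (hP : IsBestApproxSeq n ξ P) {w : ℝ} (hw : w ∈ uniformExpSet n ξ)
    (hwn : 2 * (n : ℝ) - 2 < w) :
    ∀ᶠ k in atTop, (w - n) * Real.log (polyHeight (P (k + 1))) ≤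
      (n - 1) * Real.log (polyHeight (P k)) + (Real.log (resultantConst n ξ) + w * Real.log 2) := by
  have hprime := hP.eventually_prime hn hξ hw hwn
  filter_upwards [hprime, (tendsto_add_atTop_nat 1).eventually hprime,
    hP.eventually_abs_aeval_le hw, eventually_ge_atTop 1] with k hk hk' hle hk1
  have hpos : (0 : ℝ) < polyHeight (P k) := by
    exact_mod_cast one_le_polyHeight (hP.ne_zero k hk1)
  have hpos' : (0 : ℝ) < polyHeight (P (k + 1)) := by
    exact_mod_cast one_le_polyHeight (hP.ne_zero (k + 1) (by omega))
  have hev := abs_aeval_int_pos hξ (hP.ne_zero k hk1)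
  have hK := resultantConst_pos n ξ
  have hres := one_le_of_prime_of_not_dvd (n := n) (m := n) (by omega) le_rfl hk'.1 hk'.2
    hk.2.le (hP.not_dvd_succ hk1 hk'.1 hk.1) ξ (|aeval ξ (P k)| / polyHeight (P k))
    (by positivity) (hP.abs_aeval_le_div_mul hk1 (Nat.le_succ k))
    (hP.abs_aeval_le_div_mul hk1 le_rfl)
  have hlog := Real.log_nonneg hres
  rw [Real.log_mul (by positivity) (by positivity), Real.log_mul (by positivity) (by positivity),
    Real.log_div (by positivity) (by positivity), Real.log_mul (by positivity) (by positivity),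
    Real.log_pow, Real.log_pow] at hlog
  have := hP.log_abs_aeval_le hξ hk1 hle
  linarith

theorem _root_.Good.eq_zero_of_eq {k : ℕ} (hg : Good P (k + 1)) (a b c : ℤ)
    (h : C c * P (k + 2) = C a * P (k + 1) + C b * P k) : c = 0 := by
  have hC (z : ℤ) : (C z).map (Int.castRingHom ℚ) = C (z : ℚ) := map_C _
  have h1 := congrArg ratPoly h
  simp only [ratPoly, Polynomial.map_mul, Polynomial.map_add, hC] at h1
  have h2 := Fintype.linearIndependent_iff.mp hg ![(b : ℚ), (a : ℚ), -(c : ℚ)] (by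
    rw [Fin.sum_univ_three]
    change (b : ℚ) • (P k).map _ + (a : ℚ) • (P (k + 1)).map _ +
      (-(c : ℚ)) • (P (k + 2)).map _ = 0
    simp only [smul_eq_C_mul, C_neg]
    linear_combination -h1) 2
  simpa using h2

theorem eventually_good_inequality (hn : 2 ≤ n) (hξ : Transcendental ℚ ξ)
    (hP : IsBestApproxSeq n ξ P) {w : ℝ} (hw : w ∈ uniformExpSet n ξ)
    (hwn : 2 * (n : ℝ) - 2 < w) :
    ∀ᶠ k in atTop, Good P (k + 1) →
      (w - n + 1) * Real.log (polyHeight (P (k + 1))) ≤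
      (n - 2) * Real.log (polyHeight (P k)) + Real.log (polyHeight (P (k + 2))) +
        (Real.log (resultantConst n ξ) + w * Real.log 2) := by
  have hprime := hP.eventually_prime hn hξ hw hwn
  filter_upwards [hprime, (tendsto_add_atTop_nat 1).eventually hprime,
    hP.eventually_abs_aeval_le hw, eventually_ge_atTop 1] with k hk hk' hle hk1 hgood
  have hpos : (0 : ℝ) < polyHeight (P k) := by
    exact_mod_cast one_le_polyHeight (hP.ne_zero k hk1)
  have hpos' : (0 : ℝ) < polyHeight (P (k + 1)) := by
    exact_mod_cast one_le_polyHeight (hP.ne_zero (k + 1) (by omega))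
  have hpos'' : (0 : ℝ) < polyHeight (P (k + 2)) := by
    exact_mod_cast one_le_polyHeight (hP.ne_zero (k + 2) (by omega))
  have hev := abs_aeval_int_pos hξ (hP.ne_zero k hk1)
  have hK := resultantConst_pos n ξ
  have hres := one_le_of_linearIndependent_three hn hk'.1 (hP.not_dvd_succ hk1 hk'.1 hk.1) hk'.2
    hk.2.le (hP.deg_le (k + 2) (by omega)) hgood.eq_zero_of_eq ξ
    (|aeval ξ (P k)| / polyHeight (P k)) (by positivity)
    (hP.abs_aeval_le_div_mul hk1 (Nat.le_succ k)) (hP.abs_aeval_le_div_mul hk1 le_rfl)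
    (hP.abs_aeval_le_div_mul hk1 (by omega))
  have hlog := Real.log_nonneg hres
  rw [Real.log_mul (by positivity) (by positivity), Real.log_mul (by positivity) (by positivity),
    Real.log_div (by positivity) (by positivity), Real.log_mul (by positivity) (by positivity),
    Real.log_mul (by positivity) (by positivity), Real.log_pow, Real.log_pow,
    Nat.cast_sub (by omega), Nat.cast_one] at hlog
  have := hP.log_abs_aeval_le hξ hk1 hle
  linarith

end IsBestApproxSeq

/-- Two consecutive good indices bound the cubic `R_n(w)` times a log-height by a constant. -/
theorem cubic_mul_le {n w x₀ x₁ x₂ x₃ c : ℝ} (hn : 2 ≤ n) (hw : 2 * n - 2 < w) (h01 : x₀ ≤ x₁)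
    (h₁ : (w - n + 1) * x₁ ≤ (n - 2) * x₀ + x₂ + c)
    (h₂ : (w - n + 1) * x₂ ≤ (n - 2) * x₁ + x₃ + c)
    (h₃ : (w - n) * x₃ ≤ (n - 1) * x₂ + c) :
    (w ^ 3 - (4 * n - 4) * w ^ 2 + (5 * n ^ 2 - 11 * n + 6) * w
      + (-2 * n ^ 3 + 8 * n ^ 2 - 10 * n + 3)) * x₂ ≤
      ((w - 2 * n + 3) + (w - n) * (w - 2 * n + 3) + (w - n) * (n - 2)) * c := by
  have h₁' : (w - 2 * n + 3) * x₁ ≤ x₂ + c := by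
    have := mul_le_mul_of_nonneg_left h01 (sub_nonneg.mpr hn)
    linarith
  have e₁ := mul_le_mul_of_nonneg_left h₁' (show 0 ≤ (w - n) * (n - 2) by
    apply mul_nonneg <;> linarith)
  have e₂ := mul_le_mul_of_nonneg_left h₂ (show 0 ≤ (w - n) * (w - 2 * n + 3) by
    apply mul_nonneg <;> linarith)
  have e₃ := mul_le_mul_of_nonneg_left h₃ (show 0 ≤ w - 2 * n + 3 by linarith)
  linarith

theorem cubic_pos {n γ w : ℝ} (hn : 2 ≤ n) (hγ : 2 * n - 2 < γ) (hw : γ < w)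
    (hroot : γ ^ 3 - (4 * n - 4) * γ ^ 2 + (5 * n ^ 2 - 11 * n + 6) * γ
      + (-2 * n ^ 3 + 8 * n ^ 2 - 10 * n + 3) = 0) :
    0 < w ^ 3 - (4 * n - 4) * w ^ 2 + (5 * n ^ 2 - 11 * n + 6) * w
      + (-2 * n ^ 3 + 8 * n ^ 2 - 10 * n + 3) := by
  obtain ⟨s, rfl⟩ : ∃ s, γ = 2 * n - 2 + s := ⟨γ - (2 * n - 2), by ring⟩
  obtain ⟨t, rfl⟩ : ∃ t, w = 2 * n - 2 + t := ⟨w - (2 * n - 2), by ring⟩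
  obtain ⟨m, rfl⟩ : ∃ m, n = m + 2 := ⟨n - 2, by ring⟩
  have hm : 0 ≤ m := by linarith
  have hs : 0 < s := by linarith
  have hst : s < t := by linarith
  have h3 : s ^ 3 < t ^ 3 := pow_lt_pow_left₀ hst hs.le (by norm_num)
  have h2 : (2 * m + 2) * s ^ 2 ≤ (2 * m + 2) * t ^ 2 := by gcongr
  have h1 : (m ^ 2 + m) * s ≤ (m ^ 2 + m) * t := by gcongr
  linarith

/-- conditional bound `ŵ_n(ξ) ≤ γ_n` assuming infinitely many `k ≥ 3`
with both `k-1` and `k` good. -/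
theorem stmt1 (n : ℕ) (hn : 2 ≤ n) (ξ : ℝ) (hξ : Transcendental ℚ ξ)
    (P : ℕ → Polynomial ℤ) (hP : IsBestApproxSeq n ξ P)
    (hgood : {k : ℕ | 3 ≤ k ∧ Good P (k-1) ∧ Good P k}.Infinite)
    (γ : ℝ) (hγ : γ ∈ Set.Ioo (2*(n:ℝ)-2) (2*(n:ℝ)-1))
    (hroot : γ^3 - (4*(n:ℝ)-4)*γ^2 + (5*(n:ℝ)^2-11*(n:ℝ)+6)*γ
      + (-2*(n:ℝ)^3+8*(n:ℝ)^2-10*(n:ℝ)+3) = 0) :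
    wHat n ξ ≤ (γ : EReal) := by
  by_contra! hlt
  obtain ⟨_, ⟨w, hw, rfl⟩, hγw⟩ := lt_sSup_iff.mp hlt
  have hγw' : γ < w := EReal.coe_lt_coe_iff.mp hγw
  have hwn : 2 * (n : ℝ) - 2 < w := hγ.1.trans hγw'
  have hn' : (2 : ℝ) ≤ n := by exact_mod_cast hn
  have hpos := cubic_pos hn' hγ.1 hγw' hroot
  set c := Real.log (resultantConst n ξ) + w * Real.log 2
  have hlog : Tendsto (fun k => Real.log (polyHeight (P (k + 2)))) atTop atTop :=
    Real.tendsto_log_atTop.comp (hP.tendsto_polyHeight.comp (tendsto_add_atTop_nat 2))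
  have hgi := hP.eventually_good_inequality hn hξ hw hwn
  have hri := hP.eventually_resultant_inequality hn hξ hw hwn
  obtain ⟨N, hN⟩ := eventually_atTop.mp (hgi.and (((tendsto_add_atTop_nat 1).eventually hgi).and
    (((tendsto_add_atTop_nat 2).eventually hri).and
      ((hlog.const_mul_atTop hpos).eventually_gt_atTop
        (((w - 2 * n + 3) + (w - n) * (w - 2 * n + 3) + (w - n) * (n - 2)) * c)))))
  obtain ⟨k, ⟨hk3, hg₁, hg₂⟩, hkN⟩ := hgood.exists_gt (N + 2)
  obtain ⟨t, rfl⟩ : ∃ t, k = t + 2 := ⟨k - 2, by omega⟩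
  obtain ⟨h₁, h₂, h₃, hbig⟩ := hN t (by omega)
  have hmono : Real.log (polyHeight (P t)) ≤ Real.log (polyHeight (P (t + 1))) := by
    refine Real.log_le_log ?_ ?_
    · exact_mod_cast one_le_polyHeight (hP.ne_zero t (by omega))
    · exact_mod_cast (hP.height_lt t (by omega)).le
  exact absurd (cubic_mul_le hn' hwn hmono (h₁ hg₁) (h₂ hg₂) h₃) (not_le.mpr hbig)
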